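/- Let (X,d) be a compact connected metric space, Λ a finite nonempty set, and ℱ = {X; f_λ | λ ∈ Λ} an IFS of continuous maps such that ℱⁿ is chain transitive for every positive integer n. Then: (1) the product IFS ℱ × ℱ is chain mixing; (2) ℱ × ℱ is totally chain transitive; (3) ℱ × ℱ is chain recurrent. -/

import Mathlib

/-- An `ε`-chain of length `n` from `x` to `y` for the IFS `{X; f l | l : Λ}`:
points `c 0 = x, …, c n = y` together with indices `lam i` such that
`dist (f (lam i) (c i)) (c (i+1)) < ε` for all `i < n`. -/
def IFSChain {X Λ : Type*} [MetricSpace X] (f : Λ → X → X) (ε : ℝ) (n : ℕ)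
    (x y : X) : Prop :=
  ∃ (c : ℕ → X) (lam : ℕ → Λ), c 0 = x ∧ c n = y ∧
    ∀ i < n, dist (f (lam i) (c i)) (c (i + 1)) < ε

/-- The IFS is chain transitive: any point can be joined to any other point by an
`ε`-chain, for every `ε > 0`. -/
def IFSChainTransitive {X Λ : Type*} [MetricSpace X] (f : Λ → X → X) : Prop :=
  ∀ x y : X, ∀ ε : ℝ, 0 < ε → ∃ n : ℕ, 1 ≤ n ∧ IFSChain f ε n x y

/-- The IFS is chain mixing: for every `ε > 0` there is `N > 0` such that any two
points are joined by an `ε`-chain of length exactly `n`, for every `n > N`. -/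
def IFSChainMixing {X Λ : Type*} [MetricSpace X] (f : Λ → X → X) : Prop :=
  ∀ ε : ℝ, 0 < ε → ∃ N : ℕ, 0 < N ∧ ∀ x y : X, ∀ n : ℕ, N < n → IFSChain f ε n x y

/-- The IFS is chain recurrent: every point admits an `ε`-chain (of length `≥ 1`)
back to itself, for every `ε > 0`. -/
def IFSChainRecurrent {X Λ : Type*} [MetricSpace X] (f : Λ → X → X) : Prop :=
  ∀ x : X, ∀ ε : ℝ, 0 < ε → ∃ n : ℕ, 1 ≤ n ∧ IFSChain f ε n x x

/-- The maps of the IFS `ℱⁿ`: the composition `f (lam (n-1)) ∘ ⋯ ∘ f (lam 0)`. -/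
def iterMap {X Λ : Type*} (f : Λ → X → X) (n : ℕ) (lam : Fin n → Λ) : X → X :=
  fun x => (List.ofFn lam).foldl (fun y l => f l y) x

/-- The IFS is totally chain transitive: `ℱⁿ` is chain transitive for all `n ≥ 1`. -/
def IFSTotallyChainTransitive {X Λ : Type*} [MetricSpace X] (f : Λ → X → X) : Prop :=
  ∀ n : ℕ, 1 ≤ n → IFSChainTransitive (iterMap f n)

/-- For `σ = (λ_1, λ_2, …) ∈ Λ^ℕ`, `orbitIter f σ n = ℱ_{σ_n} = f_{λ_n} ∘ ⋯ ∘ f_{λ_1}`. -/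
def orbitIter {X Λ : Type*} (f : Λ → X → X) (σ : ℕ → Λ) : ℕ → X → X
  | 0 => id
  | n + 1 => fun x => f (σ n) (orbitIter f σ n x)

/-- The IFS is topologically mixing: for every pair of nonempty open sets `U, V`
there is `N` such that for every `n > N` some `ℱ_{σ_n}` maps `U` to meet `V`. -/
def IFSTopologicallyMixing {X Λ : Type*} [MetricSpace X] (f : Λ → X → X) : Prop :=
  ∀ U V : Set X, IsOpen U → IsOpen V → U.Nonempty → V.Nonempty →
    ∃ N : ℕ, ∀ n : ℕ, N < n → ∃ σ : ℕ → Λ, (orbitIter f σ n '' U ∩ V).Nonempty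

/-- The IFS has the shadowing property: every `δ`-pseudo-orbit is `ε`-shadowed by a
genuine orbit of the IFS. -/
def IFSShadowing {X Λ : Type*} [MetricSpace X] (f : Λ → X → X) : Prop :=
  ∀ ε : ℝ, 0 < ε → ∃ δ : ℝ, 0 < δ ∧ ∀ (c : ℕ → X) (lam : ℕ → Λ),
    (∀ i : ℕ, dist (f (lam i) (c i)) (c (i + 1)) < δ) →
    ∃ (σ : ℕ → Λ) (y : X), dist (c 0) y ≤ ε ∧
      ∀ n : ℕ, 1 ≤ n → dist (c n) (orbitIter f σ n y) ≤ ε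

/-- The product IFS of `ℱ = {X; f_λ}` and `𝒢 = {Y; g_γ}`, on `X × Y` (with the sup
metric), given by the maps `(x, y) ↦ (f_λ x, g_γ y)`. -/
def prodIFS {X Y Λ Γ : Type*} (f : Λ → X → X) (g : Γ → Y → Y) :
    Λ × Γ → X × Y → X × Y :=
  fun p q => (f p.1 q.1, g p.2 q.2)

namespace IFSChain

variable {X Y Λ Γ : Type*} [MetricSpace X] [MetricSpace Y]
  {f : Λ → X → X} {g : Γ → Y → Y} {ε : ℝ}

theorem refl [Nonempty Λ] (x : X) : IFSChain f ε 0 x x :=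
  ⟨fun _ => x, fun _ => Classical.arbitrary Λ, rfl, rfl, fun _ hi => absurd hi (Nat.not_lt_zero _)⟩

theorem single {x y : X} (l : Λ) (hxy : dist (f l x) y < ε) : IFSChain f ε 1 x y := by
  refine ⟨fun i => if i = 0 then x else y, fun _ => l, rfl, rfl, fun i hi => ?_⟩
  obtain rfl : i = 0 := by omega
  simpa using hxy

theorem trans {m n : ℕ} {x y z : X} (hxy : IFSChain f ε m x y) (hyz : IFSChain f ε n y z) :
    IFSChain f ε (m + n) x z := by
  obtain ⟨c, lam, h0, hm, hc⟩ := hxy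
  obtain ⟨d, mu, k0, kn, hd⟩ := hyz
  refine ⟨fun i => if i < m then c i else d (i - m), fun i => if i < m then lam i else mu (i - m),
    ?_, by simpa using kn, fun i hi => ?_⟩
  · by_cases hm0 : 0 < m
    · simpa [hm0] using h0
    · obtain rfl : m = 0 := by omega
      simp [k0, ← hm, h0]
  · dsimp only
    by_cases him : i < m
    · by_cases him' : i + 1 < m
      · simpa [him, him'] using hc i him
      · have e : i + 1 = m := by omega
        have := hc i him
        rw [e, hm, ← k0] at this
        simpa [him, e] using this
    · have := hd (i - m) (by omega)
      rw [show i - m + 1 = i + 1 - m by omega] at this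
      simpa [him, show ¬ i + 1 < m by omega] using this

theorem loop_mul [Nonempty Λ] {k : ℕ} {x : X} (hx : IFSChain f ε k x x) (q : ℕ) :
    IFSChain f ε (k * q) x x := by
  induction q with
  | zero => exact refl x
  | succ q ih => exact ih.trans hx

theorem prod {n : ℕ} {x x' : X} {y y' : Y} (hx : IFSChain f ε n x x') (hy : IFSChain g ε n y y') :
    IFSChain (prodIFS f g) ε n (x, y) (x', y') := by
  obtain ⟨c, lam, rfl, rfl, hc⟩ := hx
  obtain ⟨d, mu, rfl, rfl, hd⟩ := hy
  exact ⟨fun i => (c i, d i), fun i => (lam i, mu i), rfl, rfl,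
    fun i hi => max_lt (hc i hi) (hd i hi)⟩

theorem perturb_endpoints {n : ℕ} {δ : ℝ} {x x' y y' : X} (hn : 0 < n) (hδ : 0 < δ)
    (hx : ∀ l, dist (f l x') (f l x) < δ) (hy : dist y y' < δ) (h : IFSChain f ε n x y) :
    IFSChain f (δ + ε + δ) n x' y' := by
  obtain ⟨c, lam, rfl, rfl, hc⟩ := h
  refine ⟨fun i => if i = 0 then x' else if i = n then y' else c i, lam, by simp,
    by simp [hn.ne'], fun i hi => ?_⟩
  set c' : ℕ → X := fun i => if i = 0 then x' else if i = n then y' else c i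
  have hstart : dist (f (lam i) (c' i)) (f (lam i) (c i)) < δ := by
    by_cases hi0 : i = 0
    · simpa [c', hi0] using hx (lam 0)
    · simpa [c', hi0, hi.ne] using hδ
  have hend : dist (c (i + 1)) (c' (i + 1)) < δ := by
    by_cases hin : i + 1 = n
    · simpa [c', hin, hn.ne'] using hy
    · simpa [c', hin] using hδ
  calc dist (f (lam i) (c' i)) (c' (i + 1))
      ≤ dist (f (lam i) (c' i)) (f (lam i) (c i)) + dist (f (lam i) (c i)) (c (i + 1))
        + dist (c (i + 1)) (c' (i + 1)) := dist_triangle4 _ _ _ _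
    _ < δ + ε + δ := by linarith [hc i hi]

end IFSChain

theorem iterMap_succ {X Λ : Type*} (f : Λ → X → X) (n : ℕ) (lam : Fin (n + 1) → Λ) (x : X) :
    iterMap f (n + 1) lam x =
      f (lam (Fin.last n)) (iterMap f n (fun i => lam i.castSucc) x) := by
  rw [iterMap, List.ofFn_succ_last, List.foldl_append]
  rfl

theorem ifsChain_iterMap {X Λ : Type*} [MetricSpace X] [Nonempty Λ] {f : Λ → X → X} {ε : ℝ}
    (hε : 0 < ε) (n : ℕ) (lam : Fin n → Λ) (x : X) : IFSChain f ε n x (iterMap f n lam x) := by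
  induction n with
  | zero => exact IFSChain.refl x
  | succ n ih =>
    exact (ih fun i => lam i.castSucc).trans
      (.single (lam (Fin.last n)) (by rw [iterMap_succ, dist_self]; exact hε))

theorem IFSChain.of_iterMap {X Λ : Type*} [MetricSpace X] [Nonempty Λ] {f : Λ → X → X} {ε : ℝ}
    (hε : 0 < ε) {k m : ℕ} (hk : 1 ≤ k) {x y : X} (h : IFSChain (iterMap f k) ε m x y) :
    IFSChain f ε (k * m) x y := by
  obtain ⟨c, lam, rfl, rfl, hc⟩ := h
  suffices ∀ i ≤ m, IFSChain f ε (k * i) (c 0) (c i) from this m le_rfl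
  intro i
  induction i with
  | zero => exact fun _ => IFSChain.refl _
  | succ i ih =>
    intro hi
    refine (ih (by omega)).trans ?_
    have hstep := hc i (by omega)
    obtain ⟨k, rfl⟩ : ∃ j, k = j + 1 := ⟨k - 1, by omega⟩
    rw [iterMap_succ] at hstep
    exact (ifsChain_iterMap hε k _ _).trans (.single _ hstep)

/-- In a totally chain transitive IFS, any two points are joined by `ε`-chains of every
sufficiently large length. -/
theorem IFSTotallyChainTransitive.eventually_ifsChain {X Λ : Type*} [MetricSpace X] [Nonempty Λ]
    {f : Λ → X → X} (h : IFSTotallyChainTransitive f) {ε : ℝ} (hε : 0 < ε) (x y : X) :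
    ∃ N, ∀ n, N < n → IFSChain f ε n x y := by
  obtain ⟨k, hk, hxx⟩ := h 1 le_rfl x x ε hε
  replace hxx := hxx.of_iterMap hε le_rfl
  rw [one_mul] at hxx
  obtain ⟨a, -, hxy⟩ := h 1 le_rfl x y ε hε
  replace hxy := hxy.of_iterMap hε le_rfl
  rw [one_mul] at hxy
  let l := Classical.arbitrary Λ
  obtain ⟨m, -, hm⟩ := h k hk (f l x) x ε hε
  have hloop : IFSChain f ε (1 + k * m) x x :=
    (IFSChain.single l (by simpa using hε)).trans (hm.of_iterMap hε hk)
  refine ⟨(1 + k * m) * k + a, fun n hn => ?_⟩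
  have hr : (n - a) % k < k := Nat.mod_lt _ hk
  have hle : (1 + k * m) * ((n - a) % k) ≤ (1 + k * m) * k := Nat.mul_le_mul_left _ hr.le
  have hdiv := Nat.mod_add_div (n - a) k
  have hle' : m * ((n - a) % k) ≤ (n - a) / k := by
    refine le_of_mul_le_mul_left (a := k) ?_ hk
    have : (1 + k * m) * ((n - a) % k) = (n - a) % k + k * (m * ((n - a) % k)) := by ring
    omega
  obtain ⟨q, hq⟩ := Nat.exists_eq_add_of_le hle'
  have hn' : n = (1 + k * m) * ((n - a) % k) + k * q + a := by
    rw [hq] at hdiv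
    have : (1 + k * m) * ((n - a) % k) + k * q
        = (n - a) % k + k * (m * ((n - a) % k) + q) := by ring
    omega
  rw [hn']
  exact ((hloop.loop_mul _).trans (hxx.loop_mul q)).trans hxy

/-- A totally chain transitive IFS on a compact space is chain mixing. -/
theorem IFSTotallyChainTransitive.ifsChainMixing {X Λ : Type*} [MetricSpace X] [CompactSpace X]
    [Finite Λ] [Nonempty Λ] {f : Λ → X → X} (hf : ∀ l, Continuous (f l))
    (h : IFSTotallyChainTransitive f) : IFSChainMixing f := by
  intro ε hε
  have hε3 : 0 < ε / 3 := by positivity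
  obtain ⟨N, hN⟩ : ∃ N, ∀ p ∈ (Set.univ : Set (X × X)), ∀ n, N < n → IFSChain f ε n p.1 p.2 := by
    refine isCompact_univ.induction_on
      (p := fun s : Set (X × X) => ∃ N, ∀ p ∈ s, ∀ n, N < n → IFSChain f ε n p.1 p.2)
      ⟨0, by simp⟩ (fun s t hst ⟨N, hN⟩ => ⟨N, fun p hp => hN p (hst hp)⟩) ?_ ?_
    · rintro s t ⟨M, hM⟩ ⟨N, hN⟩
      refine ⟨max M N, ?_⟩
      rintro p (hp | hp) n hn
      · exact hM p hp n (lt_of_le_of_lt (le_max_left _ _) hn)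
      · exact hN p hp n (lt_of_le_of_lt (le_max_right _ _) hn)
    · rintro ⟨x, y⟩ -
      obtain ⟨N, hN⟩ := h.eventually_ifsChain hε3 x y
      have hx : ∀ᶠ x' in nhds x, ∀ l, dist (f l x') (f l x) < ε / 3 :=
        Filter.eventually_all.2 fun l =>
          (hf l).continuousAt.eventually (Metric.ball_mem_nhds (f l x) hε3)
      have hy : ∀ᶠ y' in nhds y, dist y' y < ε / 3 := Metric.ball_mem_nhds y hε3
      refine ⟨_, mem_nhdsWithin_of_mem_nhds (hx.prod_nhds hy), N, fun p hp n hn => ?_⟩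
      have := (hN n hn).perturb_endpoints (by omega) hε3 hp.1 (by rw [dist_comm]; exact hp.2)
      rwa [add_thirds] at this
  exact ⟨N + 1, by omega, fun x y n hn => hN (x, y) trivial n (by omega)⟩

theorem IFSChainMixing.prod {X Y Λ Γ : Type*} [MetricSpace X] [MetricSpace Y]
    {f : Λ → X → X} {g : Γ → Y → Y} (hf : IFSChainMixing f) (hg : IFSChainMixing g) :
    IFSChainMixing (prodIFS f g) := by
  intro ε hε
  obtain ⟨M, hM, hfM⟩ := hf ε hε
  obtain ⟨N, -, hgN⟩ := hg ε hε
  exact ⟨M + N, by omega, fun p q n hn =>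
    (hfM p.1 q.1 n (by omega)).prod (hgN p.2 q.2 n (by omega))⟩

theorem IFSChainMixing.ifsChainRecurrent {X Λ : Type*} [MetricSpace X] {f : Λ → X → X}
    (h : IFSChainMixing f) : IFSChainRecurrent f := by
  intro x ε hε
  obtain ⟨N, -, hN⟩ := h ε hε
  exact ⟨N + 1, by omega, hN x x _ (by omega)⟩

/-- Over a fixed number of steps, sufficiently fine pseudo-orbits stay close to true orbits. -/
theorem exists_dist_iterMap_lt {X Λ : Type*} [MetricSpace X] [CompactSpace X] [Finite Λ]
    {f : Λ → X → X} (hf : ∀ l, Continuous (f l)) (n : ℕ) {ε : ℝ} (hε : 0 < ε) :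
    ∃ δ > 0, ∀ (c : ℕ → X) (lam : ℕ → Λ), (∀ i < n, dist (f (lam i) (c i)) (c (i + 1)) < δ) →
      dist (iterMap f n (fun i => lam i) (c 0)) (c n) < ε := by
  induction n generalizing ε with
  | zero => exact ⟨1, one_pos, fun c lam _ => by simpa [iterMap] using hε⟩
  | succ n ih =>
    have := Fintype.ofFinite Λ
    obtain ⟨η, hη, hfη⟩ := Metric.uniformContinuous_iff.1
      (CompactSpace.uniformContinuous_of_continuous (continuous_pi hf)) (ε / 2) (half_pos hε)
    obtain ⟨δ, hδ, hn⟩ := ih hη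
    refine ⟨min δ (ε / 2), lt_min hδ (half_pos hε), fun c lam hc => ?_⟩
    have hdist := hn c lam fun i hi => (hc i (by omega)).trans_le (min_le_left _ _)
    rw [iterMap_succ]
    calc dist (f (lam n) (iterMap f n (fun i => lam i) (c 0))) (c (n + 1))
        ≤ dist (f (lam n) (iterMap f n (fun i => lam i) (c 0))) (f (lam n) (c n))
          + dist (f (lam n) (c n)) (c (n + 1)) := dist_triangle _ _ _
      _ < ε / 2 + ε / 2 := add_lt_add
          ((dist_pi_lt_iff (half_pos hε)).1 (hfη hdist) (lam n))
          ((hc n (by omega)).trans_le (min_le_right _ _))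
      _ = ε := add_halves ε

/-- A chain mixing IFS of continuous maps on a compact space is totally chain transitive. -/
theorem IFSChainMixing.ifsTotallyChainTransitive {X Λ : Type*} [MetricSpace X] [CompactSpace X]
    [Finite Λ] {f : Λ → X → X} (hf : ∀ l, Continuous (f l)) (h : IFSChainMixing f) :
    IFSTotallyChainTransitive f := by
  intro n hn x y ε hε
  obtain ⟨δ, hδ, hclose⟩ := exists_dist_iterMap_lt hf n hε
  obtain ⟨N, -, hN⟩ := h δ hδ
  obtain ⟨c, lam, rfl, rfl, hc⟩ := hN x y (n * (N + 1)) (by nlinarith)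
  refine ⟨N + 1, by omega, fun i => c (n * i), fun i j => lam (n * i + j), by simp, rfl,
    fun i hi => ?_⟩
  refine hclose (fun j => c (n * i + j)) (fun j => lam (n * i + j)) fun j hj => hc _ ?_
  calc n * i + j < n * (i + 1) := by rw [mul_add_one]; omega
    _ ≤ n * (N + 1) := Nat.mul_le_mul_left _ hi

/-- For an IFS of continuous maps on a compact connected metric space
such that `ℱⁿ` is chain transitive for every `n ≥ 1`, the product IFS `ℱ × ℱ` is
(1) chain mixing, (2) totally chain transitive, and (3) chain recurrent. -/
theorem ifs_product_chain_properties
    {X Λ : Type*} [MetricSpace X] [CompactSpace X] [ConnectedSpace X]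
    [Finite Λ] [Nonempty Λ]
    (f : Λ → X → X) (hf : ∀ l : Λ, Continuous (f l))
    (h : ∀ n : ℕ, 1 ≤ n → IFSChainTransitive (iterMap f n)) :
    IFSChainMixing (prodIFS f f) ∧
    IFSTotallyChainTransitive (prodIFS f f) ∧
    IFSChainRecurrent (prodIFS f f) := by
  have hmix : IFSChainMixing f := IFSTotallyChainTransitive.ifsChainMixing hf h
  have hprod := hmix.prod hmix
  have hcont : ∀ p, Continuous (prodIFS f f p) := fun p => (hf p.1).prodMap (hf p.2)
  exact ⟨hprod, hprod.ifsTotallyChainTransitive hcont, hprod.ifsChainRecurrent⟩
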